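/- arXiv:2112.15322 — 3 statements merged into one kernel-verified Lean document; each statement's English description precedes it below -/
import Mathlib

section
/- Let α ∈ (0,1) be a real number, i a natural number, and set γ_j = 1 − (1 − α²)^j. For all real numbers c ≥ 0 and t with t ≥ γ_i·c, it holds that γ_{i+1}·c − t ≤ α·(c − t). -/
/-- For α ∈ (0,1), γ_j = 1 − (1 − α²)^j, c ≥ 0 and t ≥ γ_i·c, we have
γ_{i+1}·c − t ≤ α·(c − t). -/
theorem stmt_1 (α : ℝ) (hα : α ∈ Set.Ioo (0 : ℝ) 1) (i : ℕ)
    (γ : ℕ → ℝ) (hγ : ∀ j : ℕ, γ j = 1 - (1 - α ^ 2) ^ j) :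
    ∀ c t : ℝ, 0 ≤ c → γ i * c ≤ t → γ (i + 1) * c - t ≤ α * (c - t) := by
  intro c t hc ht
  obtain ⟨h0, h1⟩ := hα
  rw [hγ] at ht
  rw [hγ, pow_succ]
  have hp : 0 ≤ (1 - α ^ 2) ^ i := pow_nonneg (by nlinarith) i
  generalize (1 - α ^ 2) ^ i = p at *
  have h2 : 0 ≤ α * p * (1 - α) * c :=
    mul_nonneg (mul_nonneg (mul_nonneg h0.le hp) (by linarith)) hc
  have h3 := mul_le_mul_of_nonneg_left ht (show 0 ≤ 1 - α by linarith)
  nlinarith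
end

section
/- Let n, t, c be natural numbers with 1 ≤ c ≤ n and 1 ≤ t and 3·t ≤ n, and set p = t/n (as a real number). Then Σ_{x ∈ {0,…,c}, 2x ≥ c} (C(t,x)·C(n−t, c−x))/C(n,c) ≤ exp(−c·((1/2)·ln((1/2)/p) + (1/2)·ln((1/2)/(1 − p)))), where C(a,b) denotes the binomial coefficient. -/
open Finset Real

lemma aux_choose (n t : ℕ) (h : t ≤ n) (k : ℕ) :
    n ^ k * t.choose k ≤ t ^ k * n.choose k := by
  induction k with
  | zero => simp
  | succ k ih =>
    have h1 := Nat.choose_succ_right_eq t k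
    have h2 := Nat.choose_succ_right_eq n k
    have h3 : n * (t - k) ≤ t * (n - k) := by
      rw [Nat.mul_sub, Nat.mul_sub, Nat.mul_comm t n]
      have := Nat.mul_le_mul_right k h
      omega
    refine Nat.le_of_mul_le_mul_right ?_ (Nat.succ_pos k)
    calc n ^ (k+1) * t.choose (k+1) * (k+1) = n ^ (k+1) * (t.choose (k+1) * (k+1)) := by ring
      _ = (n ^ k * t.choose k) * (n * (t - k)) := by rw [h1]; ring
      _ ≤ (t ^ k * n.choose k) * (t * (n - k)) := Nat.mul_le_mul ih h3
      _ = t ^ (k+1) * (n.choose (k+1) * (k+1)) := by rw [h2]; ring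
      _ = _ := (mul_assoc _ _ _).symm

lemma aux_vand (t m k j : ℕ) :
    ∑ x ∈ range (k + j + 1), t.choose x * m.choose (k + j - x) * x.choose k
      = t.choose k * (t + m - k).choose j := by
  rw [add_assoc, Finset.sum_range_add]
  rw [Finset.sum_eq_zero (s := range k)]
  · rw [zero_add]
    rcases lt_or_ge t k with h | h
    · rw [Nat.choose_eq_zero_of_lt h, zero_mul]
      apply Finset.sum_eq_zero
      intro x _
      rw [Nat.choose_eq_zero_of_lt (show t < k + x by omega)]; simp
    · rw [show t + m - k = (t - k) + m by omega, Nat.add_choose_eq,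
        Finset.Nat.sum_antidiagonal_eq_sum_range_succ_mk, Finset.mul_sum]
      apply Finset.sum_congr rfl
      intro x _
      have := Nat.choose_mul (n := t) (k := k + x) (s := k) (by omega)
      rw [Nat.add_sub_cancel_left] at this
      rw [show k + j - (k + x) = j - x by omega]
      simp only
      rw [mul_right_comm, this]; ring
  · intro x hx
    rw [Nat.choose_eq_zero_of_lt (Finset.mem_range.1 hx)]; simp

lemma aux_mgf (n t c : ℕ) (hn : 0 < n) (h : t ≤ n) (d : ℝ) (hd : 0 ≤ d) :
    ∑ x ∈ range (c + 1), ((t.choose x : ℝ) * ((n - t).choose (c - x) : ℝ)) * (1 + d) ^ x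
      ≤ n.choose c * (1 + (t : ℝ) / n * d) ^ c := by
  have e1 : ∀ x ∈ range (c + 1), (1 + d) ^ x = ∑ k ∈ range (c + 1), (x.choose k : ℝ) * d ^ k := by
    intro x hx
    have hx' : x + 1 ≤ c + 1 := by have := Finset.mem_range.1 hx; omega
    rw [add_comm, add_pow]
    rw [← Finset.sum_subset (Finset.range_mono hx')]
    · apply Finset.sum_congr rfl
      intro k _
      simp [mul_comm]
    · intro k _ hk
      rw [Nat.choose_eq_zero_of_lt (by simpa using hk)]; simp
  rw [Finset.sum_congr rfl (fun x hx => by rw [e1 x hx, Finset.mul_sum]), Finset.sum_comm]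
  rw [add_comm (1 : ℝ), add_pow, Finset.mul_sum]
  apply Finset.sum_le_sum
  intro k hk
  obtain ⟨j, rfl⟩ : ∃ j, c = k + j := ⟨c - k, by have := Finset.mem_range.1 hk; omega⟩
  have e2 : ∑ x ∈ range (k + j + 1), (t.choose x : ℝ) * ((n - t).choose (k + j - x) : ℝ)
      * ((x.choose k : ℝ) * d ^ k) = (t.choose k : ℝ) * ((n - k).choose j : ℝ) * d ^ k := by
    have := aux_vand t (n - t) k j
    rw [show t + (n - t) - k = n - k by omega] at this
    have h' : (∑ x ∈ range (k + j + 1), (t.choose x : ℝ) * ((n - t).choose (k + j - x) : ℝ)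
      * (x.choose k : ℝ)) = (t.choose k : ℝ) * ((n - k).choose j : ℝ) := by exact_mod_cast this
    rw [← h', Finset.sum_mul]
    apply Finset.sum_congr rfl
    intro x _
    ring
  rw [e2]
  have h1 : (n : ℝ) ^ k * t.choose k ≤ (t : ℝ) ^ k * n.choose k := by
    exact_mod_cast aux_choose n t h k
  have h2 := Nat.choose_mul (n := n) (k := k + j) (s := k) (by omega)
  rw [Nat.add_sub_cancel_left] at h2
  have h3 : (n.choose (k + j) : ℝ) * (k + j).choose k = n.choose k * (n - k).choose j := by
    exact_mod_cast h2
  have hn' : (0 : ℝ) < n := by exact_mod_cast hn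
  have h4 : (t.choose k : ℝ) ≤ ((t : ℝ) / n) ^ k * n.choose k := by
    rw [div_pow, div_mul_eq_mul_div, le_div_iff₀ (by positivity)]
    linarith
  calc (t.choose k : ℝ) * ((n - k).choose j : ℝ) * d ^ k
      ≤ (((t : ℝ) / n) ^ k * n.choose k) * ((n - k).choose j : ℝ) * d ^ k := by gcongr
    _ = ((t : ℝ) / n) ^ k * d ^ k * (n.choose k * (n - k).choose j) := by ring
    _ = _ := by rw [← h3, mul_pow]; simp; ring


/-- KL-divergence tail bound for the hypergeometric distribution: sampling c of n nodes
of which t ≤ n/3 are malicious, Pr[X ≥ c/2] ≤ exp(−D(1/2 ‖ p)·c) with p = t/n and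
D(1/2 ‖ p) = (1/2)·ln((1/2)/p) + (1/2)·ln((1/2)/(1−p)). -/
theorem stmt_11 (n t c : ℕ) (hc1 : 1 ≤ c) (hcn : c ≤ n) (ht : 1 ≤ t) (htn : 3 * t ≤ n) :
    ∑ x ∈ (Finset.range (c + 1)).filter (fun x : ℕ => c ≤ 2 * x),
        ((t.choose x : ℝ) * ((n - t).choose (c - x) : ℝ)) / (n.choose c : ℝ)
      ≤ Real.exp (-(c : ℝ) *
          ((1 / 2) * Real.log ((1 / 2) / ((t : ℝ) / n))
            + (1 / 2) * Real.log ((1 / 2) / (1 - (t : ℝ) / n)))) := by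
  have hn : 0 < n := by omega
  have hn' : (0 : ℝ) < n := by exact_mod_cast hn
  have ht' : (0 : ℝ) < t := by exact_mod_cast ht
  have htn' : 3 * (t : ℝ) ≤ n := by exact_mod_cast htn
  have key := aux_mgf n t c hn (by omega)
  set p : ℝ := (t : ℝ) / n with hp
  have hp0 : 0 < p := by positivity
  have hp3 : p ≤ 1 / 3 := by rw [hp, div_le_iff₀ hn']; linarith
  have hq : 0 < 1 - p := by linarith
  have hd : 0 ≤ (1 - 2 * p) / p := div_nonneg (by linarith) hp0.le
  have key := key _ hd
  have hs : 1 + (1 - 2 * p) / p = (1 - p) / p := by field_simp; ring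
  have hm : 1 + p * ((1 - 2 * p) / p) = 2 * (1 - p) := by field_simp; ring
  rw [hs, hm] at key
  have hs1 : 1 ≤ (1 - p) / p := by rw [le_div_iff₀ hp0]; linarith
  set s : ℝ := (1 - p) / p with hsdef
  have hs0 : 0 < s := by linarith
  set r : ℝ := Real.sqrt s with hr
  have hr1 : 1 ≤ r := Real.one_le_sqrt.2 hs1
  have hr2 : r ^ 2 = s := Real.sq_sqrt hs0.le
  have hC : (0 : ℝ) < n.choose c := by exact_mod_cast Nat.choose_pos hcn
  set L : ℝ := (1 / 2) * Real.log ((1 / 2) / p) + (1 / 2) * Real.log ((1 / 2) / (1 - p)) with hL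
  have hE : Real.exp (-(c : ℝ) * L) = Real.exp (-L) ^ c := by
    rw [← Real.exp_nat_mul]; congr 1; ring
  have hE2 : Real.exp (-L) ^ 2 = 4 * p * (1 - p) := by
    rw [← Real.exp_nat_mul]
    have : ((2 : ℕ) : ℝ) * -L = -(Real.log ((1 / 2) / p) + Real.log ((1 / 2) / (1 - p))) := by
      rw [hL]; push_cast; ring
    rw [this, Real.exp_neg, Real.exp_add, Real.exp_log (by positivity),
      Real.exp_log (by positivity)]
    field_simp
    norm_num
  have hEr : Real.exp (-L) * r = 2 * (1 - p) := by
    have h0 : 0 ≤ Real.exp (-L) * r := by positivity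
    refine (sq_eq_sq₀ h0 (by linarith)).1 ?_
    rw [mul_pow, hE2, hr2, hsdef]
    field_simp
    ring
  rw [hE, ← Finset.sum_div, div_le_iff₀ hC]
  have hrc : 0 < r ^ c := by positivity
  refine le_of_mul_le_mul_right ?_ hrc
  calc _ = ∑ x ∈ (Finset.range (c + 1)).filter (fun x : ℕ => c ≤ 2 * x),
        ((t.choose x : ℝ) * ((n - t).choose (c - x) : ℝ)) * r ^ c := by rw [Finset.sum_mul]
    _ ≤ ∑ x ∈ (Finset.range (c + 1)).filter (fun x : ℕ => c ≤ 2 * x),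
        ((t.choose x : ℝ) * ((n - t).choose (c - x) : ℝ)) * s ^ x := by
        apply Finset.sum_le_sum
        intro x hx
        have hx2 := (Finset.mem_filter.1 hx).2
        have : r ^ c ≤ s ^ x := by
          rw [← hr2, ← pow_mul]
          exact pow_le_pow_right₀ hr1 hx2
        gcongr
    _ ≤ ∑ x ∈ Finset.range (c + 1),
        ((t.choose x : ℝ) * ((n - t).choose (c - x) : ℝ)) * s ^ x :=
        Finset.sum_le_sum_of_subset_of_nonneg (Finset.filter_subset _ _)
          (fun _ _ _ => by positivity)
    _ ≤ n.choose c * (2 * (1 - p)) ^ c := key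
    _ = _ := by rw [← hEr, mul_pow]; ring
end

section
/- Let n, t, c be natural numbers with 1 ≤ c ≤ n and 1 ≤ t ≤ n, set p = t/n (as a real number), and let λ > 0 be a real number with p + λ < 1. Then Σ_{x ∈ {0,…,c}, x ≥ (p+λ)·c} (C(t,x)·C(n−t, c−x))/C(n,c) ≤ exp(−c·((p+λ)·ln((p+λ)/p) + (1−p−λ)·ln((1−p−λ)/(1 − p)))), where C(a,b) denotes the binomial coefficient. -/
open Finset Real

lemma choose_ratio (n t k : ℕ) (h : t ≤ n) : t.choose k * n ^ k ≤ n.choose k * t ^ k := by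
  induction k with
  | zero => simp
  | succ k ih =>
    have h1 := Nat.choose_succ_right_eq t k
    have h2 := Nat.choose_succ_right_eq n k
    have h3 : (t - k) * n ≤ (n - k) * t := by
      rw [Nat.sub_mul, Nat.sub_mul, Nat.mul_comm t n]
      exact Nat.sub_le_sub_left (Nat.mul_le_mul_left k h) _
    refine Nat.le_of_mul_le_mul_right ?_ (show 0 < k + 1 by omega)
    calc t.choose (k+1) * n ^ (k+1) * (k+1) = (t.choose (k+1) * (k+1)) * n ^ (k+1) := by ring
      _ = (t.choose k * n ^ k) * ((t - k) * n) := by rw [h1]; ring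
      _ ≤ (n.choose k * t ^ k) * ((n - k) * t) := Nat.mul_le_mul ih h3
      _ = (n.choose (k+1) * (k+1)) * t ^ (k+1) := by rw [h2]; ring
      _ = _ := by ring

lemma fact_moment (t m c k : ℕ) (hk : k ≤ c) :
    ∑ x ∈ range (c + 1), t.choose x * m.choose (c - x) * x.choose k
      = t.choose k * (t + m - k).choose (c - k) := by
  rcases Nat.lt_or_ge t k with h | h
  · rw [Nat.choose_eq_zero_of_lt h, Nat.zero_mul]
    refine Finset.sum_eq_zero fun x _ => ?_
    rcases Nat.lt_or_ge t x with h' | h'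
    · simp [Nat.choose_eq_zero_of_lt h']
    · simp [Nat.choose_eq_zero_of_lt (lt_of_le_of_lt h' h)]
  · obtain ⟨d, rfl⟩ := Nat.exists_eq_add_of_le hk
    obtain ⟨s, rfl⟩ := Nat.exists_eq_add_of_le h
    rw [show k + d + 1 = k + (d + 1) by ring, Finset.sum_range_add,
      Finset.sum_eq_zero, zero_add, show k + s + m - k = s + m by omega,
      show k + d - k = d by omega, Nat.add_choose_eq s m d,
      Finset.Nat.sum_antidiagonal_eq_sum_range_succ (fun i j => s.choose i * m.choose j),
      Finset.mul_sum]
    · refine Finset.sum_congr rfl fun x hx => ?_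
      rw [show k + d - (k + x) = d - x by omega]
      rcases Nat.lt_or_ge s x with h' | h'
      · rw [Nat.choose_eq_zero_of_lt h', Nat.choose_eq_zero_of_lt (show k + s < k + x by omega)]
        simp
      · have := Nat.choose_mul (n := k + s) (k := k + x) (s := k) (by omega)
        rw [show k + s - k = s by omega, show k + x - k = x by omega] at this
        calc _ = ((k+s).choose (k+x) * (k+x).choose k) * m.choose (d-x) := by ring
          _ = _ := by rw [this]; ring
    · intro x hx
      simp [Nat.choose_eq_zero_of_lt (Finset.mem_range.1 hx)]

lemma mgf_bound (n t c : ℕ) (hn : 0 < n) (hcn : c ≤ n) (htn : t ≤ n) (y : ℝ) (hy : 0 ≤ y) :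
    ∑ x ∈ range (c + 1), ((t.choose x : ℝ) * ((n - t).choose (c - x) : ℝ)) * (1 + y) ^ x
      ≤ (n.choose c : ℝ) * (1 + (t : ℝ) / n * y) ^ c := by
  have e1 : ∀ x ∈ range (c + 1), (1 + y) ^ x = ∑ k ∈ range (c + 1), y ^ k * (x.choose k : ℝ) := by
    intro x hx
    rw [add_comm 1 y, add_pow]
    simp only [one_pow, mul_one]
    refine Finset.sum_subset (by intro k; simp at *; omega) fun k _ hk => ?_
    rw [Nat.choose_eq_zero_of_lt (by simp at hk; omega)]; simp
  calc _ = ∑ x ∈ range (c + 1), ∑ k ∈ range (c + 1),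
          y ^ k * ((t.choose x * (n - t).choose (c - x) * x.choose k : ℕ) : ℝ) := by
        refine Finset.sum_congr rfl fun x hx => ?_
        rw [e1 x hx, Finset.mul_sum]
        refine Finset.sum_congr rfl fun k _ => ?_
        push_cast; ring
    _ = ∑ k ∈ range (c + 1), y ^ k * ((t.choose k * (n - k).choose (c - k) : ℕ) : ℝ) := by
        rw [Finset.sum_comm]
        refine Finset.sum_congr rfl fun k hk => ?_
        rw [← Finset.mul_sum, ← Nat.cast_sum, fact_moment t (n - t) c k (by simp at hk; omega),
          show t + (n - t) - k = n - k by omega]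
    _ ≤ ∑ k ∈ range (c + 1), (n.choose c : ℝ) * (((t : ℝ) / n * y) ^ k * (c.choose k : ℝ)) := by
        refine Finset.sum_le_sum fun k hk => ?_
        have hk' : k ≤ c := by simp at hk; omega
        have a1 : (t.choose k : ℝ) ≤ n.choose k * ((t : ℝ) / n) ^ k := by
          rw [div_pow, ← mul_div_assoc, le_div_iff₀ (by positivity)]
          exact_mod_cast choose_ratio n t k htn
        have a2 : (n.choose c : ℝ) * c.choose k = n.choose k * (n - k).choose (c - k) := by
          exact_mod_cast Nat.choose_mul (n := n) (k := c) (s := k) (by omega)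
        calc _ = y ^ k * ((n - k).choose (c - k) : ℝ) * (t.choose k : ℝ) := by push_cast; ring
          _ ≤ y ^ k * ((n - k).choose (c - k) : ℝ) * (n.choose k * ((t : ℝ) / n) ^ k) := by gcongr
          _ = (n.choose k * (n - k).choose (c - k) : ℝ) * (((t : ℝ) / n) ^ k * y ^ k) := by ring
          _ = _ := by rw [← a2, mul_pow]; ring
    _ = _ := by
        rw [← Finset.mul_sum, add_comm 1, add_pow]; simp

/-- KL-divergence tail bound for the hypergeometric distribution: sampling c of n nodes
of which t are malicious, with p = t/n and λ > 0 with p + λ < 1,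
Pr[X ≥ (p+λ)·c] ≤ exp(−D(p+λ ‖ p)·c) with
D(a ‖ p) = a·ln(a/p) + (1−a)·ln((1−a)/(1−p)). -/
theorem stmt_12 (n t c : ℕ) (hc1 : 1 ≤ c) (hcn : c ≤ n) (ht1 : 1 ≤ t) (htn : t ≤ n)
    (l : ℝ) (hl : 0 < l) (hpl : (t : ℝ) / n + l < 1) :
    ∑ x ∈ (Finset.range (c + 1)).filter (fun x : ℕ => ((t : ℝ) / n + l) * c ≤ (x : ℝ)),
        ((t.choose x : ℝ) * ((n - t).choose (c - x) : ℝ)) / (n.choose c : ℝ)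
      ≤ Real.exp (-(c : ℝ) *
          (((t : ℝ) / n + l) * Real.log (((t : ℝ) / n + l) / ((t : ℝ) / n))
            + (1 - (t : ℝ) / n - l) * Real.log ((1 - (t : ℝ) / n - l) / (1 - (t : ℝ) / n)))) := by
  have hn : 0 < n := by omega
  have hnR : (0 : ℝ) < n := by exact_mod_cast hn
  have htR : (0 : ℝ) < t := by exact_mod_cast ht1
  have hp : 0 < (t : ℝ) / n := by positivity
  have M := mgf_bound n t c hn hcn htn
  generalize (t : ℝ) / n = p at *
  obtain ⟨a, rfl⟩ : ∃ a, l = a - p := ⟨l + p, by ring⟩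
  rw [show p + (a - p) = a by ring] at *
  rw [show 1 - p - (a - p) = 1 - a by ring]
  have hpa : p < a := by linarith
  have ha : 0 < a := by linarith
  have h1a : 0 < 1 - a := by linarith
  have h1p : 0 < 1 - p := by linarith
  have hC : (0 : ℝ) < n.choose c := by exact_mod_cast Nat.choose_pos hcn
  have hy : 0 ≤ (a - p) / (p * (1 - a)) := by positivity
  specialize M _ hy
  have hz : 1 + (a - p) / (p * (1 - a)) = (a / p) * ((1 - p) / (1 - a)) := by
    field_simp; ring
  have hw : 1 + p * ((a - p) / (p * (1 - a))) = (1 - p) / (1 - a) := by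
    field_simp; ring
  have hz1 : 1 ≤ (a / p) * ((1 - p) / (1 - a)) := by rw [← hz]; linarith
  rw [hz, hw] at M
  set z := (a / p) * ((1 - p) / (1 - a)) with hzdef
  have hz0 : 0 < z := by linarith
  have hlz : 0 ≤ Real.log z := Real.log_nonneg hz1
  have key : Real.exp (-(a * c) * Real.log z) * ((1 - p) / (1 - a)) ^ c
      = Real.exp (-(c : ℝ) * (a * Real.log (a / p) + (1 - a) * Real.log ((1 - a) / (1 - p)))) := by
    have hq : 0 < (1 - p) / (1 - a) := by positivity
    have e : ((1 - p) / (1 - a)) ^ c = Real.exp (c * Real.log ((1 - p) / (1 - a))) := by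
      rw [Real.exp_nat_mul, Real.exp_log hq]
    have e2 : Real.log ((1 - a) / (1 - p)) = - Real.log ((1 - p) / (1 - a)) := by
      rw [← Real.log_inv, inv_div]
    rw [e, ← Real.exp_add, e2, hzdef, Real.log_mul (by positivity) hq.ne']
    congr 1; ring
  rw [← key, ← Finset.sum_div, div_le_iff₀ hC]
  calc _ ≤ ∑ x ∈ (Finset.range (c + 1)).filter (fun x : ℕ => a * c ≤ (x : ℝ)),
          Real.exp (-(a * c) * Real.log z)
            * (((t.choose x : ℝ) * ((n - t).choose (c - x) : ℝ)) * z ^ x) := by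
        refine Finset.sum_le_sum fun x hx => ?_
        have hx' := (Finset.mem_filter.1 hx).2
        have e : z ^ x = Real.exp (x * Real.log z) := by
          rw [Real.exp_nat_mul, Real.exp_log hz0]
        have e1 : 1 ≤ Real.exp (-(a * c) * Real.log z) * z ^ x := by
          rw [e, ← Real.exp_add]
          apply Real.one_le_exp
          nlinarith
        have e0 : (0 : ℝ) ≤ (t.choose x : ℝ) * ((n - t).choose (c - x) : ℝ) := by positivity
        calc _ ≤ ((t.choose x : ℝ) * ((n - t).choose (c - x) : ℝ))
              * (Real.exp (-(a * c) * Real.log z) * z ^ x) := le_mul_of_one_le_right e0 e1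
          _ = _ := by ring
    _ ≤ ∑ x ∈ Finset.range (c + 1), Real.exp (-(a * c) * Real.log z)
            * (((t.choose x : ℝ) * ((n - t).choose (c - x) : ℝ)) * z ^ x) :=
        Finset.sum_le_sum_of_subset_of_nonneg (Finset.filter_subset _ _)
          fun x _ _ => by positivity
    _ ≤ Real.exp (-(a * c) * Real.log z) * ((n.choose c : ℝ) * ((1 - p) / (1 - a)) ^ c) := by
        rw [← Finset.mul_sum]
        exact mul_le_mul_of_nonneg_left M (Real.exp_pos _).le
    _ = _ := by ring
end
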